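/- In the per-step LAZOa setup, let Ã^s = Ã ∩ (−Ã) be the largest symmetric subset of Ã, and define the bias term b̃(u) = (d/(2δ))·(f_t(x_t + δu) − 2f_{t−1}(w_{t−1}) + f_t(x_t − δu))·u·1_{Ã∖Ã^s}(u). Then E_u[g(u)] = ∇f_{δ,t}(x_t) + E_u[b̃(u)], where f_{δ,t} is the smoothed version of f_t. -/

import Mathlib

open MeasureTheory Pointwise

/-- The uniform probability measure on the closed unit ball of `ℝ^d`. -/
noncomputable def ballUniform (d : ℕ) : Measure (EuclideanSpace ℝ (Fin d)) :=
  (volume (Metric.closedBall (0 : EuclideanSpace ℝ (Fin d)) 1))⁻¹ •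
    volume.restrict (Metric.closedBall (0 : EuclideanSpace ℝ (Fin d)) 1)

/-- The uniform (rotation-invariant) probability measure on the unit sphere of `ℝ^d`,
realized as the pushforward of the uniform measure on the unit ball under the radial
projection `v ↦ v / ‖v‖`. -/
noncomputable def sphereUniform (d : ℕ) : Measure (EuclideanSpace ℝ (Fin d)) :=
  Measure.map (fun v => ‖v‖⁻¹ • v) (ballUniform d)

/-- The smoothed version `f_δ(x) = E_{v ~ uniform ball} [f (x + δ v)]`. -/
noncomputable def smoothed (d : ℕ) (f : EuclideanSpace ℝ (Fin d) → ℝ) (δ : ℝ)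
    (x : EuclideanSpace ℝ (Fin d)) : ℝ :=
  ∫ v, f (x + δ • v) ∂(ballUniform d)

/-- The asymmetric part `A ∖ A^s` of a set, where `A^s = A ∩ (−A)` is the largest
symmetric subset of `A`. -/
def asymPart {d : ℕ} (A : Set (EuclideanSpace ℝ (Fin d))) : Set (EuclideanSpace ℝ (Fin d)) :=
  A \ (A ∩ -A)

section SphereDivergence

theorem lipschitzWith_tent {E : Type*} [NormedAddCommGroup E] (R : ℝ) :
    LipschitzWith 1 (fun v : E => max 0 (R - ‖v‖)) := by
  refine LipschitzWith.const_max ?_ 0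
  simpa using (LipschitzWith.const' R (K := 0)).sub (lipschitzWith_one_norm (E := E))

variable {E : Type*} [NormedAddCommGroup E] [InnerProductSpace ℝ E]

theorem hasLineDerivAt_norm {x : E} (hx : x ≠ 0) (e : E) :
    HasLineDerivAt ℝ (fun v : E => ‖v‖) (inner ℝ (‖x‖⁻¹ • x) e) x e := by
  have h1 : HasDerivAt (fun t : ℝ => x + t • e) e 0 := by
    simpa using ((hasDerivAt_id (0 : ℝ)).smul_const e).const_add x
  have h2 := h1.norm_sq.sqrt (by simpa using hx)
  simp only [zero_smul, add_zero, Real.sqrt_sq (norm_nonneg _)] at h2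
  unfold HasLineDerivAt
  rw [show inner ℝ (‖x‖⁻¹ • x) e = 2 * inner ℝ x e / (2 * ‖x‖) by
    rw [real_inner_smul_left, mul_div_mul_left _ _ two_ne_zero, inv_mul_eq_div]]
  exact h2

theorem lineDeriv_tent_of_norm_lt {R : ℝ} {x : E} (hx : x ≠ 0) (hR : ‖x‖ < R) (e : E) :
    lineDeriv ℝ (fun v : E => max 0 (R - ‖v‖)) x e = -inner ℝ (‖x‖⁻¹ • x) e := by
  have h : HasLineDerivAt ℝ (fun v : E => R - ‖v‖) (-inner ℝ (‖x‖⁻¹ • x) e) x e :=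
    HasDerivAt.const_sub R (hasLineDerivAt_norm hx e)
  refine (h.congr_of_eventuallyEq ?_).lineDeriv
  filter_upwards [(isOpen_lt continuous_norm continuous_const).mem_nhds hR] with v hv
  exact max_eq_right (sub_nonneg.2 (le_of_lt hv))

theorem lineDeriv_tent_of_lt_norm {R : ℝ} {x : E} (hR : R < ‖x‖) (e : E) :
    lineDeriv ℝ (fun v : E => max 0 (R - ‖v‖)) x e = 0 := by
  have h : HasLineDerivAt ℝ (fun _ : E => (0 : ℝ)) 0 x e := hasDerivAt_const _ _
  refine (h.congr_of_eventuallyEq ?_).lineDeriv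
  filter_upwards [(isOpen_lt continuous_const continuous_norm).mem_nhds hR] with v hv
  exact max_eq_left (sub_nonpos.2 (le_of_lt hv))

theorem norm_inv_norm_smul_le (v : E) : ‖‖v‖⁻¹ • v‖ ≤ 1 := by
  rw [norm_smul, norm_inv, norm_norm]
  exact inv_mul_le_one

variable [FiniteDimensional ℝ E]

theorem hasCompactSupport_tent (R : ℝ) :
    HasCompactSupport (fun v : E => max 0 (R - ‖v‖)) := by
  refine HasCompactSupport.intro (isCompact_closedBall (0 : E) R) fun v hv => ?_
  rw [mem_closedBall_zero_iff, not_le] at hv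
  exact max_eq_left (by linarith)

variable [MeasurableSpace E] [BorelSpace E]
  (μ : Measure E) [μ.IsAddHaarMeasure]

theorem setIntegral_closedBall_radial (φ : E → ℝ) {R : ℝ} (hR : 0 < R) :
    ∫ v in Metric.closedBall 0 R, φ (‖v‖⁻¹ • v) ∂μ =
      R ^ Module.finrank ℝ E * ∫ v in Metric.closedBall 0 1, φ (‖v‖⁻¹ • v) ∂μ := by
  have h := Measure.setIntegral_comp_smul_of_pos μ (fun v : E => φ (‖v‖⁻¹ • v))
    (Metric.closedBall 0 1) hR
  have e1 : ∀ x : E, ‖R • x‖⁻¹ • R • x = ‖x‖⁻¹ • x := fun x => by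
    rw [norm_smul, Real.norm_of_nonneg hR.le, smul_smul, mul_inv, mul_right_comm,
      inv_mul_cancel₀ hR.ne', one_mul]
  have e2 : R • Metric.closedBall (0 : E) 1 = Metric.closedBall 0 R := by
    rw [smul_closedBall _ _ zero_le_one, smul_zero, Real.norm_of_nonneg hR.le, mul_one]
  simp only [e1, e2] at h
  rw [h, smul_eq_mul, mul_inv_cancel_left₀ (by positivity)]

theorem abs_setIntegral_shell_le {R B : ℝ} (hR : 1 ≤ R) {f : E → ℝ}
    (hf : ∀ v ∈ Metric.closedBall (0 : E) R \ Metric.closedBall 0 1, |f v| ≤ B) :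
    |∫ v in Metric.closedBall (0 : E) R \ Metric.closedBall 0 1, f v ∂μ| ≤
      B * ((R ^ Module.finrank ℝ E - 1) * μ.real (Metric.closedBall 0 1)) := by
  have hfin : μ (Metric.closedBall (0 : E) R) < ⊤ := measure_closedBall_lt_top
  have h := norm_setIntegral_le_of_norm_le_const (μ := μ) (f := f) (C := B)
    ((measure_mono Set.sdiff_subset).trans_lt hfin) hf
  rw [measureReal_sdiff (Metric.closedBall_subset_closedBall hR)
      Metric.isClosed_closedBall.measurableSet,
    Measure.addHaar_real_closedBall' μ 0 (zero_le_one.trans hR)] at h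
  rw [sub_mul, one_mul]
  exact h

variable [Nontrivial E]

theorem integral_lineDeriv_mul_tent {C : NNReal} {h : E → ℝ} (hh : LipschitzWith C h) (e : E)
    {R : ℝ} :
    ∫ v, lineDeriv ℝ h v e * max 0 (R - ‖v‖) ∂μ =
      ∫ v in Metric.closedBall 0 R, h v * inner ℝ (‖v‖⁻¹ • v) e ∂μ := by
  rw [hh.integral_lineDeriv_mul_eq (lipschitzWith_tent R) (hasCompactSupport_tent R) e,
    ← integral_indicator Metric.isClosed_closedBall.measurableSet]
  have h0 : ∀ᵐ v ∂μ, v ∉ Metric.sphere (0 : E) 0 := measure_eq_zero_iff_ae_notMem.1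
    (Measure.addHaar_sphere μ 0 0)
  have h1 : ∀ᵐ v ∂μ, v ∉ Metric.sphere (0 : E) R := measure_eq_zero_iff_ae_notMem.1
    (Measure.addHaar_sphere μ 0 R)
  refine integral_congr_ae ?_
  filter_upwards [h0, h1] with v hv0 hvR
  simp only [mem_sphere_zero_iff_norm, norm_eq_zero] at hv0 hvR
  rcases lt_or_gt_of_ne hvR with hlt | hgt
  · rw [Set.indicator_of_mem (by simpa using hlt.le), lineDeriv_neg,
      lineDeriv_tent_of_norm_lt hv0 hlt]
    ring
  · rw [Set.indicator_of_notMem (by simpa using hgt), lineDeriv_neg,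
      lineDeriv_tent_of_lt_norm hgt]
    simp

theorem abs_integral_lineDeriv_sub_le {C : NNReal} {h : E → ℝ} (hh : LipschitzWith C h) (e : E)
    {R : ℝ} (hR : 1 < R) :
    |(R - 1) * ∫ v in Metric.closedBall 0 1, lineDeriv ℝ h v e ∂μ -
      (R ^ Module.finrank ℝ E - 1) *
        ∫ v in Metric.closedBall 0 1, h (‖v‖⁻¹ • v) * inner ℝ (‖v‖⁻¹ • v) e ∂μ| ≤
      2 * (C * ‖e‖ * (R - 1) *
        ((R ^ Module.finrank ℝ E - 1) * μ.real (Metric.closedBall 0 1))) := by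
  have hB : ∀ r : ℝ, MeasurableSet (Metric.closedBall (0 : E) r) := fun r =>
    Metric.isClosed_closedBall.measurableSet
  have hsub : Metric.closedBall (0 : E) 1 ⊆ Metric.closedBall 0 R :=
    Metric.closedBall_subset_closedBall hR.le
  have hld : ∀ v, |lineDeriv ℝ h v e| ≤ C * ‖e‖ := fun v =>
    norm_lineDeriv_le_of_lipschitz ℝ hh
  have hli : LocallyIntegrable (fun v => lineDeriv ℝ h v e) μ := hh.locallyIntegrable_lineDeriv e
  have hmeas : Measurable (fun v : E => ‖v‖⁻¹ • v) := by fun_prop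
  have hin : ∀ v : E, |inner ℝ (‖v‖⁻¹ • v) e| ≤ ‖e‖ := fun v =>
    (abs_real_inner_le_norm _ _).trans
      (mul_le_of_le_one_left (norm_nonneg _) (norm_inv_norm_smul_le v))
  have hinm : Measurable (fun v : E => inner ℝ (‖v‖⁻¹ • v) e) := by fun_prop
  have hp : ∀ r, IntegrableOn (fun v => h v * inner ℝ (‖v‖⁻¹ • v) e)
      (Metric.closedBall 0 r) μ := fun r =>
    (hh.continuous.continuousOn.integrableOn_compact (isCompact_closedBall 0 r)).mul_bdd
      hinm.aestronglyMeasurable (Filter.Eventually.of_forall hin)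
  have hφ : ∀ r, IntegrableOn (fun v => h (‖v‖⁻¹ • v) * inner ℝ (‖v‖⁻¹ • v) e)
      (Metric.closedBall 0 r) μ := fun r => by
    obtain ⟨K, hK⟩ := (isCompact_closedBall (0 : E) 1).exists_bound_of_continuousOn
      hh.continuous.continuousOn
    have hc : IntegrableOn (fun v => inner ℝ (‖v‖⁻¹ • v) e) (Metric.closedBall 0 r) μ :=
      Measure.integrableOn_of_bounded (M := ‖e‖) measure_closedBall_lt_top.ne
        hinm.aestronglyMeasurable (Filter.Eventually.of_forall hin)
    exact hc.bdd_mul (c := K) (hh.continuous.measurable.comp hmeas).aestronglyMeasurable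
      (Filter.Eventually.of_forall fun v => hK _ (by simpa using norm_inv_norm_smul_le v))
  have key1 : |∫ v in Metric.closedBall 0 R \ Metric.closedBall 0 1,
      (h v * inner ℝ (‖v‖⁻¹ • v) e - h (‖v‖⁻¹ • v) * inner ℝ (‖v‖⁻¹ • v) e) ∂μ| ≤
      C * ‖e‖ * (R - 1) * ((R ^ Module.finrank ℝ E - 1) * μ.real (Metric.closedBall 0 1)) := by
    refine abs_setIntegral_shell_le μ (B := C * ‖e‖ * (R - 1)) hR.le fun v hv => ?_
    simp only [Set.mem_sdiff, mem_closedBall_zero_iff, not_le] at hv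
    have hv0 : 0 < ‖v‖ := zero_lt_one.trans hv.2
    have hd : dist v (‖v‖⁻¹ • v) = ‖v‖ - 1 := by
      have : v - ‖v‖⁻¹ • v = (1 - ‖v‖⁻¹) • v := by rw [sub_smul, one_smul]
      rw [dist_eq_norm, this, norm_smul, Real.norm_of_nonneg
        (sub_nonneg.2 (inv_le_one_of_one_le₀ hv.2.le)), sub_mul, one_mul,
        inv_mul_cancel₀ hv0.ne']
    have hl : |h v - h (‖v‖⁻¹ • v)| ≤ C * (R - 1) := by
      have := hh.dist_le_mul v (‖v‖⁻¹ • v)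
      rw [hd, Real.dist_eq] at this
      exact this.trans (by gcongr; exact hv.1)
    rw [← sub_mul, abs_mul, mul_right_comm]
    exact mul_le_mul hl (hin v) (abs_nonneg _) (by have := C.2; nlinarith)
  have key2 : |∫ v in Metric.closedBall 0 R \ Metric.closedBall 0 1,
      lineDeriv ℝ h v e * max 0 (R - ‖v‖) ∂μ| ≤
      C * ‖e‖ * (R - 1) * ((R ^ Module.finrank ℝ E - 1) * μ.real (Metric.closedBall 0 1)) := by
    refine abs_setIntegral_shell_le μ (B := C * ‖e‖ * (R - 1)) hR.le fun v hv => ?_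
    simp only [Set.mem_sdiff, mem_closedBall_zero_iff, not_le] at hv
    rw [abs_mul, max_eq_right (sub_nonneg.2 hv.1), abs_of_nonneg (sub_nonneg.2 hv.1)]
    exact mul_le_mul (hld v) (by linarith [hv.2]) (by linarith [hv.1]) (by positivity)
  have hK : ∀ r, Integrable (fun v => lineDeriv ℝ h v e * max 0 (r - ‖v‖)) μ := fun r => by
    refine Integrable.bdd_mul (c := C * ‖e‖)
      ((lipschitzWith_tent r).continuous.integrable_of_hasCompactSupport
        (hasCompactSupport_tent r)) hli.aestronglyMeasurable (Filter.Eventually.of_forall hld)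
  have hKball : ∀ r, ∫ v in Metric.closedBall 0 r, lineDeriv ℝ h v e * max 0 (r - ‖v‖) ∂μ =
      ∫ v, lineDeriv ℝ h v e * max 0 (r - ‖v‖) ∂μ := fun r => by
    refine setIntegral_eq_integral_of_forall_compl_eq_zero fun v hv => ?_
    rw [mem_closedBall_zero_iff, not_le] at hv
    rw [max_eq_left (by linarith), mul_zero]
  have hinner : ∫ v in Metric.closedBall 0 1, lineDeriv ℝ h v e * max 0 (R - ‖v‖) ∂μ =
      (R - 1) * (∫ v in Metric.closedBall 0 1, lineDeriv ℝ h v e ∂μ) +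
      ∫ v in Metric.closedBall 0 1, lineDeriv ℝ h v e * max 0 (1 - ‖v‖) ∂μ := by
    rw [← integral_const_mul, ← integral_add
      ((hli.integrableOn_isCompact (isCompact_closedBall 0 1)).const_mul _)
      (hK 1).integrableOn]
    refine setIntegral_congr_fun (hB 1) fun v hv => ?_
    rw [mem_closedBall_zero_iff] at hv
    rw [max_eq_right (by linarith), max_eq_right (by linarith)]
    ring
  rw [integral_sub ((hp R).mono_set Set.sdiff_subset) ((hφ R).mono_set Set.sdiff_subset),
    setIntegral_sdiff (hB 1) (hp R) hsub, setIntegral_sdiff (hB 1) (hφ R) hsub,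
    setIntegral_closedBall_radial μ (fun u => h u * inner ℝ u e) (zero_lt_one.trans hR),
    ← integral_lineDeriv_mul_tent μ hh e, ← integral_lineDeriv_mul_tent μ hh e] at key1
  rw [setIntegral_sdiff (hB 1) (hK R).integrableOn hsub, hKball R, hinner, hKball 1] at key2
  rw [abs_le] at key1 key2 ⊢
  constructor <;> linarith [key1.1, key1.2, key2.1, key2.2]

/-- The divergence theorem on the unit ball for a Lipschitz function, with the surface integral
expressed through the radial projection. -/
theorem integral_closedBall_lineDeriv {C : NNReal} {h : E → ℝ} (hh : LipschitzWith C h) (e : E) :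
    ∫ v in Metric.closedBall 0 1, lineDeriv ℝ h v e ∂μ =
      Module.finrank ℝ E *
        ∫ v in Metric.closedBall 0 1, h (‖v‖⁻¹ • v) * inner ℝ (‖v‖⁻¹ • v) e ∂μ := by
  set J := ∫ v in Metric.closedBall 0 1, lineDeriv ℝ h v e ∂μ
  set I := ∫ v in Metric.closedBall 0 1, h (‖v‖⁻¹ • v) * inner ℝ (‖v‖⁻¹ • v) e ∂μ
  set n := Module.finrank ℝ E
  set V := μ.real (Metric.closedBall (0 : E) 1)
  have hle : ∀ R : ℝ, 1 < R → |J - (∑ i ∈ Finset.range n, R ^ i) * I| ≤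
      2 * (C * ‖e‖ * ((R ^ n - 1) * V)) := fun R hR => by
    have h1 := abs_integral_lineDeriv_sub_le μ hh e hR
    have h2 : (0 : ℝ) < R - 1 := sub_pos.2 hR
    refine le_of_mul_le_mul_left ?_ h2
    calc (R - 1) * |J - (∑ i ∈ Finset.range n, R ^ i) * I|
        = |(R - 1) * J - (R ^ n - 1) * I| := by
          rw [← geom_sum_mul R n, ← abs_of_pos h2, ← abs_mul, abs_of_pos h2]
          congr 1
          ring
      _ ≤ _ := h1
      _ = _ := by ring
  have hlim1 : Filter.Tendsto (fun R : ℝ => |J - (∑ i ∈ Finset.range n, R ^ i) * I|)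
      (nhdsWithin 1 (Set.Ioi 1)) (nhds |J - n * I|) := by
    have : Continuous (fun R : ℝ => |J - (∑ i ∈ Finset.range n, R ^ i) * I|) := by fun_prop
    simpa using (this.tendsto 1).mono_left nhdsWithin_le_nhds
  have hlim2 : Filter.Tendsto (fun R : ℝ => 2 * (C * ‖e‖ * ((R ^ n - 1) * V)))
      (nhdsWithin 1 (Set.Ioi 1)) (nhds 0) := by
    have : Continuous (fun R : ℝ => 2 * (C * ‖e‖ * ((R ^ n - 1) * V))) := by fun_prop
    simpa using (this.tendsto 1).mono_left nhdsWithin_le_nhds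
  have := le_of_tendsto_of_tendsto hlim1 hlim2
    (Filter.mem_of_superset self_mem_nhdsWithin fun R hR => hle R hR)
  exact sub_eq_zero.1 (abs_nonpos_iff.1 this)

end SphereDivergence

section UniformMeasures

variable {d : ℕ}

local notation "ℝd" => EuclideanSpace ℝ (Fin d)

theorem integral_ballUniform {F : Type*} [NormedAddCommGroup F] [NormedSpace ℝ F] (f : ℝd → F) :
    ∫ v, f v ∂(ballUniform d) =
      ((volume (Metric.closedBall (0 : ℝd) 1))⁻¹).toReal •
        ∫ v in Metric.closedBall 0 1, f v := by
  rw [ballUniform, integral_smul_measure]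

instance isFiniteMeasure_ballUniform : IsFiniteMeasure (ballUniform d) := by
  have : IsFiniteMeasure (volume.restrict (Metric.closedBall (0 : ℝd) 1)) :=
    isFiniteMeasure_restrict.2 measure_closedBall_lt_top.ne
  exact Measure.smul_finite _
    (ENNReal.inv_ne_top.2 (Metric.measure_closedBall_pos _ _ zero_lt_one).ne')

theorem ballUniform_absolutelyContinuous : ballUniform d ≪ volume :=
  Measure.restrict_le_self.absolutelyContinuous.smul_left _

theorem measurable_radialProjection : Measurable (fun v : ℝd => ‖v‖⁻¹ • v) := by
  fun_prop

instance isFiniteMeasure_sphereUniform : IsFiniteMeasure (sphereUniform d) :=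
  Measure.isFiniteMeasure_map _ _

instance isNegInvariant_sphereUniform : (sphereUniform d).IsNegInvariant := by
  have h1 : MeasurePreserving (Neg.neg : ℝd → ℝd) (ballUniform d) (ballUniform d) := by
    have h := (Measure.measurePreserving_neg (volume : Measure ℝd)).restrict_preimage
      (Metric.isClosed_closedBall (x := (0 : ℝd)) (ε := 1)).measurableSet
    have hB : (Neg.neg : ℝd → ℝd) ⁻¹' Metric.closedBall 0 1 = Metric.closedBall 0 1 := by
      ext v; simp
    rw [hB] at h
    exact h.smul_measure _
  constructor
  rw [Measure.neg, sphereUniform, Measure.map_map measurable_neg measurable_radialProjection]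
  conv_rhs => rw [← h1.map_eq, Measure.map_map measurable_radialProjection measurable_neg]
  congr 1
  ext1 v
  simp

theorem integrable_sphereUniform_of_continuous {F : Type*} [NormedAddCommGroup F]
    {f : ℝd → F} (hf : Continuous f) : Integrable f (sphereUniform d) := by
  have hmem : ∀ᵐ u ∂(sphereUniform d), u ∈ Metric.closedBall (0 : ℝd) 1 := by
    exact (ae_map_iff measurable_radialProjection.aemeasurable
      (Metric.isClosed_closedBall (x := (0 : ℝd)) (ε := 1)).measurableSet).2
      (Filter.Eventually.of_forall fun v => by simpa using norm_inv_norm_smul_le v)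
  rw [← Measure.restrict_eq_self_of_ae_mem hmem]
  exact hf.continuousOn.integrableOn_compact (isCompact_closedBall 0 1)

theorem lipschitzWith_comp_add_smul {C : NNReal} {f : ℝd → ℝ} (hf : LipschitzWith C f) {δ : ℝ}
    (hδ : 0 < δ) (x : ℝd) :
    LipschitzWith (C * δ.toNNReal) (fun v : ℝd => f (x + δ • v)) := by
  refine hf.comp (LipschitzWith.of_dist_le_mul fun v w => ?_)
  rw [dist_add_left, dist_smul₀, Real.norm_of_nonneg hδ.le, Real.coe_toNNReal _ hδ.le]

theorem hasFDerivAt_smoothed {C : NNReal} {f : ℝd → ℝ} (hf : LipschitzWith C f) {δ : ℝ}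
    (hδ : 0 < δ) (x : ℝd) :
    Integrable (fun v => δ⁻¹ • fderiv ℝ (fun w : ℝd => f (x + δ • w)) v) (ballUniform d) ∧
    HasFDerivAt (smoothed d f δ)
      (∫ v, δ⁻¹ • fderiv ℝ (fun w : ℝd => f (x + δ • w)) v ∂(ballUniform d)) x := by
  have hcont : ∀ y : ℝd, Continuous fun v : ℝd => f (y + δ • v) := fun y =>
    hf.continuous.comp (by fun_prop)
  have hlip := lipschitzWith_comp_add_smul hf hδ x
  have hmeas : Measurable fun v => δ⁻¹ • fderiv ℝ (fun w : ℝd => f (x + δ • w)) v :=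
    (measurable_fderiv ℝ _).const_smul δ⁻¹
  refine hasFDerivAt_integral_of_dominated_loc_of_lip (F := fun y v => f (y + δ • v))
    (bound := fun _ => (C : ℝ)) Filter.univ_mem
    (Filter.Eventually.of_forall fun y => (hcont y).aestronglyMeasurable) ?_
    hmeas.aestronglyMeasurable
    (Filter.Eventually.of_forall fun v => ?_) (integrable_const _) ?_
  · have : IntegrableOn (fun v : ℝd => f (x + δ • v)) (Metric.closedBall 0 1) volume :=
      (hcont x).continuousOn.integrableOn_compact (isCompact_closedBall 0 1)
    exact Integrable.smul_measure this
      (ENNReal.inv_ne_top.2 (Metric.measure_closedBall_pos _ _ zero_lt_one).ne')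
  · refine (LipschitzWith.of_dist_le_mul fun y z => ?_).lipschitzOnWith
    simpa using hf.dist_le_mul (y + δ • v) (z + δ • v)
  · filter_upwards [ballUniform_absolutelyContinuous.ae_le hlip.ae_differentiableAt] with v hv
    have hinv : HasFDerivAt (fun y : ℝd => δ⁻¹ • (y + δ • v - x))
        (δ⁻¹ • ContinuousLinearMap.id ℝ ℝd) x :=
      (((hasFDerivAt_id x).add_const (δ • v)).sub_const x).const_smul δ⁻¹
    have hval : δ⁻¹ • (x + δ • v - x) = v := by
      rw [add_sub_cancel_left, inv_smul_smul₀ hδ.ne']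
    have hcomp := HasFDerivAt.comp x (hval.symm ▸ hv.hasFDerivAt) hinv
    convert! hcomp using 1
    · ext y
      simp [smul_inv_smul₀ hδ.ne']
    · rw [hval]
      ext e
      simp

/-- The one-point sphere estimator is an unbiased gradient estimator of the smoothed function. -/
theorem hasGradientAt_smoothed (hd : 1 ≤ d) {C : NNReal} {f : ℝd → ℝ} (hf : LipschitzWith C f)
    {δ : ℝ} (hδ : 0 < δ) (x : ℝd) :
    HasGradientAt (smoothed d f δ) (∫ u, ((d : ℝ) / δ * f (x + δ • u)) • u ∂(sphereUniform d))
      x := by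
  have : Nonempty (Fin d) := ⟨⟨0, hd⟩⟩
  obtain ⟨hint, hder⟩ := hasFDerivAt_smoothed hf hδ x
  have hlip := lipschitzWith_comp_add_smul hf hδ x
  have hcont := hf.continuous
  have hgrad : Integrable (fun u : ℝd => ((d : ℝ) / δ * f (x + δ • u)) • u) (sphereUniform d) :=
    integrable_sphereUniform_of_continuous (by fun_prop)
  rw [hasGradientAt_iff_hasFDerivAt]
  convert! hder using 1
  ext e
  rw [ContinuousLinearMap.integral_apply hint, InnerProductSpace.toDual_apply_apply,
    real_inner_comm, ← integral_inner hgrad, sphereUniform,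
    integral_map measurable_radialProjection.aemeasurable
      (Continuous.aestronglyMeasurable (by fun_prop))]
  have hae : ∀ᵐ v ∂(ballUniform d),
      (δ⁻¹ • fderiv ℝ (fun w : ℝd => f (x + δ • w)) v) e =
        δ⁻¹ * lineDeriv ℝ (fun w : ℝd => f (x + δ • w)) v e := by
    filter_upwards [ballUniform_absolutelyContinuous.ae_le hlip.ae_differentiableAt] with v hv
    rw [hv.lineDeriv_eq_fderiv]
    simp
  have hinn : ∀ v : ℝd, inner ℝ e (((d : ℝ) / δ * f (x + δ • ‖v‖⁻¹ • v)) • ‖v‖⁻¹ • v) =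
      (d : ℝ) / δ * (f (x + δ • ‖v‖⁻¹ • v) * inner ℝ (‖v‖⁻¹ • v) e) := fun v => by
    rw [real_inner_smul_right, real_inner_comm, mul_assoc]
  rw [integral_congr_ae hae]
  simp only [hinn]
  rw [integral_const_mul, integral_const_mul, integral_ballUniform, integral_ballUniform,
    integral_closedBall_lineDeriv volume hlip e, finrank_euclideanSpace_fin, smul_eq_mul,
    smul_eq_mul]
  ring

end UniformMeasures

/-- Bias identity for the (per-step) LAZOa gradient estimator (Lemma 3, part (a)):
`E_u[g(u)] = ∇f_{δ,t}(x_t) + E_u[b̃(u)]`. -/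
theorem stmt12 (d : ℕ) (hd : 1 ≤ d) (δ η D L : ℝ) (hδ : 0 < δ) (hη : 0 < η) (hD : 0 < D)
    (hL : 0 ≤ L)
    (ft ftm : EuclideanSpace ℝ (Fin d) → ℝ)
    (hft : ∀ x y, |ft x - ft y| ≤ L * ‖x - y‖)
    (hftm : ∀ x y, |ftm x - ftm y| ≤ L * ‖x - y‖)
    (xt xtm utm : EuclideanSpace ℝ (Fin d)) (hutm : ‖utm‖ = 1) :
    (∫ u, (if |ft (xt + δ • u) - ftm (xtm + δ • utm)| ≤
              D * ‖xt - xtm + δ • (u - utm)‖ then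
            ((d : ℝ) / δ * (ft (xt + δ • u) - ftm (xtm + δ • utm))) • u
          else
            ((d : ℝ) / (2 * δ) * (ft (xt + δ • u) - ft (xt - δ • u))) • u)
        ∂(sphereUniform d)) =
      gradient (smoothed d ft δ) xt +
        ∫ u, (asymPart
            {w : EuclideanSpace ℝ (Fin d) |
              |ft (xt + δ • w) - ftm (xtm + δ • utm)| ≤
                D * ‖xt - xtm + δ • (w - utm)‖}).indicator
          (fun u => ((d : ℝ) / (2 * δ) *
            (ft (xt + δ • u) - 2 * ftm (xtm + δ • utm) + ft (xt - δ • u))) • u) u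
          ∂(sphereUniform d) := by
  have hlip : LipschitzWith L.toNNReal ft := LipschitzWith.of_dist_le_mul fun x y => by
    rw [Real.coe_toNNReal _ hL, dist_eq_norm x y]
    exact hft x y
  have hc := hlip.continuous
  rw [(hasGradientAt_smoothed hd hlip hδ xt).gradient]
  set c := ftm (xtm + δ • utm)
  set A : Set (EuclideanSpace ℝ (Fin d)) :=
    {w | |ft (xt + δ • w) - c| ≤ D * ‖xt - xtm + δ • (w - utm)‖}
  have hAm : MeasurableSet A := (isClosed_le (by fun_prop) (by fun_prop)).measurableSet
  set b : EuclideanSpace ℝ (Fin d) → EuclideanSpace ℝ (Fin d) := fun u =>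
    ((d : ℝ) / (2 * δ) * (ft (xt + δ • u) - 2 * c + ft (xt - δ • u))) • u with hb
  set q : EuclideanSpace ℝ (Fin d) → EuclideanSpace ℝ (Fin d) := fun u =>
    ((d : ℝ) / δ * ft (xt + δ • u)) • u with hq
  have hbi : Integrable b (sphereUniform d) :=
    integrable_sphereUniform_of_continuous (by fun_prop)
  have hqi : Integrable q (sphereUniform d) :=
    integrable_sphereUniform_of_continuous (by fun_prop)
  have hasym : Integrable ((asymPart A).indicator b) (sphereUniform d) :=
    hbi.indicator (hAm.diff (hAm.inter hAm.neg))
  have hsym : Integrable ((A ∩ -A).indicator b) (sphereUniform d) :=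
    hbi.indicator (hAm.inter hAm.neg)
  have hodd : ∀ u, (A ∩ -A).indicator b (-u) = -(A ∩ -A).indicator b u := fun u => by
    by_cases hu : u ∈ A ∩ -A
    · have hu' : -u ∈ A ∩ -A := ⟨hu.2, by simpa using hu.1⟩
      rw [Set.indicator_of_mem hu, Set.indicator_of_mem hu', hb]
      simp only [smul_neg, sub_neg_eq_add, ← sub_eq_add_neg]
      congr 3
      ring
    · have hu' : -u ∉ A ∩ -A := fun h => hu ⟨by simpa using h.2, h.1⟩
      rw [Set.indicator_of_notMem hu, Set.indicator_of_notMem hu', neg_zero]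
  have hzero : ∫ u, (A ∩ -A).indicator b u ∂(sphereUniform d) = 0 := by
    have h := integral_neg_eq_self ((A ∩ -A).indicator b) (sphereUniform d)
    simp only [hodd, integral_neg] at h
    have h2 := add_eq_zero_iff_eq_neg.2 h.symm
    rw [← two_smul ℝ] at h2
    exact (smul_eq_zero.1 h2).resolve_left two_ne_zero
  have hqneg : ∫ u, q (-u) ∂(sphereUniform d) = ∫ u, q u ∂(sphereUniform d) :=
    integral_neg_eq_self q (sphereUniform d)
  have hdecomp : ∀ u, (if |ft (xt + δ • u) - c| ≤ D * ‖xt - xtm + δ • (u - utm)‖ then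
        ((d : ℝ) / δ * (ft (xt + δ • u) - c)) • u
      else ((d : ℝ) / (2 * δ) * (ft (xt + δ • u) - ft (xt - δ • u))) • u) =
      ((2 : ℝ)⁻¹ • q u + (2 : ℝ)⁻¹ • q (-u)) +
        ((asymPart A).indicator b u + (A ∩ -A).indicator b u) := fun u => by
    have hqq : (2 : ℝ)⁻¹ • q u + (2 : ℝ)⁻¹ • q (-u) =
        ((d : ℝ) / (2 * δ) * (ft (xt + δ • u) - ft (xt - δ • u))) • u := by
      simp only [hq, smul_neg, ← sub_eq_add_neg, smul_smul, ← sub_smul]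
      congr 1
      field_simp
    have hind : (asymPart A).indicator b u + (A ∩ -A).indicator b u = A.indicator b u := by
      rw [asymPart, Set.indicator_sdiff Set.inter_subset_left, Pi.sub_apply, sub_add_cancel]
    rw [hqq, hind]
    by_cases hu : u ∈ A
    · refine (if_pos hu).trans ?_
      rw [Set.indicator_of_mem hu, hb, ← add_smul]
      congr 1
      field_simp
      ring
    · refine (if_neg hu).trans ?_
      rw [Set.indicator_of_notMem hu, add_zero]
  simp only [hdecomp]
  have hq1 : Integrable (fun u => (2 : ℝ)⁻¹ • q u) (sphereUniform d) :=
    hqi.fun_smul _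
  have hq2 : Integrable (fun u => (2 : ℝ)⁻¹ • q (-u)) (sphereUniform d) :=
    hqi.comp_neg.fun_smul _
  rw [integral_add (hq1.fun_add hq2) (hasym.fun_add hsym), integral_add hq1 hq2,
    integral_add hasym hsym, integral_smul,
    integral_smul, hqneg, hzero, add_zero, ← add_smul]
  norm_num
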